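/- Let K be an imaginary quadratic field, O an order in K of conductor ℓ_O, and N a positive integer. The inclusion I(O, ℓ_O N) ↪ I(O, N) induces a group isomorphism C_N(O, ℓ_O N) = I(O, ℓ_O N)/P_N(O, ℓ_O N) ≅ C_N(O) = I(O, N)/P_N(O). -/

import Mathlib

open scoped nonZeroDivisors

set_option synthInstance.maxHeartbeats 1000000
set_option maxHeartbeats 1000000

noncomputable section

variable (K : Type) [Field K] [NumberField K]

/-- The fractional `O`-ideals of `K` (for `O` a subring of `K`). -/
abbrev Frac (O : Subalgebra ℤ K) := FractionalIdeal ((O : Type))⁰ K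

/-- A nonzero ideal `a` of `O` is *prime to* `m` if `a + mO = O`. -/
def primeTo (O : Subalgebra ℤ K) (m : ℕ) (a : Ideal O) : Prop :=
  a ⊔ Ideal.span {(m : O)} = ⊤

/-- `M(O, m)`: the nonzero proper (equivalently, invertible) `O`-ideals prime to `m`. -/
def Mset (O : Subalgebra ℤ K) (m : ℕ) : Set (Ideal O) :=
  {a | a ≠ 0 ∧ primeTo K O m a ∧ IsUnit (a : Frac K O)}

/-- `I(O, m)`: the subgroup of the group of invertible fractional `O`-ideals generated by
`M(O, m)`. -/
def Igrp (O : Subalgebra ℤ K) (m : ℕ) : Subgroup (Frac K O)ˣ :=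
  Subgroup.closure {u | ∃ a ∈ Mset K O m, (u : Frac K O) = a}

/-- `O` is an order of the imaginary quadratic field `K`:  `K` has degree 2 over `ℚ`, has no
real embeddings, and `O` is a subring of `K` which is finitely generated as a ℤ-module and
contains a ℚ-basis of `K` (i.e. spans `K` over ℚ). -/
structure IsImagQuadOrder (O : Subalgebra ℤ K) : Prop where
  degree_two : Module.finrank ℚ K = 2
  no_real_embedding : ∀ v : NumberField.InfinitePlace K, v.IsComplex
  fg : (Subalgebra.toSubmodule O).FG
  spans : Submodule.span ℚ (O : Set K) = ⊤

/-- `P_N(O, m)`: the subgroup generated by the principal ideals `νO` with `ν ∈ O` nonzero,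
`νO` prime to `m`, and `ν ≡ 1 (mod NO)`. -/
def PgrpM (O : Subalgebra ℤ K) (N m : ℕ) : Subgroup (Frac K O)ˣ :=
  Subgroup.closure {u | ∃ ν : (O : Type), ν ≠ 0 ∧ primeTo K O m (Ideal.span {ν}) ∧
    (∃ μ : (O : Type), ν = 1 + (N : (O : Type)) * μ) ∧
    (u : Frac K O) = ((Ideal.span {ν} : Ideal O) : Frac K O)}

/-- `P_N(O)`: the subgroup generated by the principal ideals `νO` with `ν ∈ O` nonzero and
`ν ≡ 1 (mod NO)`. -/
def Pgrp (O : Subalgebra ℤ K) (N : ℕ) : Subgroup (Frac K O)ˣ :=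
  Subgroup.closure {u | ∃ ν : (O : Type), ν ≠ 0 ∧ (∃ μ : (O : Type), ν = 1 + (N : (O : Type)) * μ) ∧
    (u : Frac K O) = ((Ideal.span {ν} : Ideal O) : Frac K O)}

/-- The ray class group `C_N(O) = I(O, N)/P_N(O)` of the order `O` modulo `NO`. -/
abbrev ClsGrp (O : Subalgebra ℤ K) (N : ℕ) :=
  (Igrp K O N) ⧸ ((Pgrp K O N).subgroupOf (Igrp K O N))

/-- `C_N(O, m) = I(O, m)/P_N(O, m)`. -/
abbrev ClsGrpM (O : Subalgebra ℤ K) (N m : ℕ) :=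
  (Igrp K O m) ⧸ ((PgrpM K O N m).subgroupOf (Igrp K O m))

/-- The condOrder `ℓ_O = [O_K : O]`, as the index of `O` in the maximal order (the integral
closure of `ℤ` in `K`) as additive subgroups of `K`. -/
def condOrder (O : Subalgebra ℤ K) : ℕ :=
  AddSubgroup.relIndex (Subalgebra.toSubmodule O).toAddSubgroup
    (Subalgebra.toSubmodule (integralClosure ℤ K)).toAddSubgroup

/-- An inclusion `A ≤ B` of subgroups of a commutative group induces an isomorphism `A / P ≃* B / Q`
as soon as `P ≤ Q`, `A ⊓ Q ≤ P` and `B ≤ A Q`. -/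
theorem exists_mulEquiv_quotient_subgroupOf {G : Type*} [CommGroup G] {A B P Q : Subgroup G}
    (hAB : A ≤ B) (hPQ : P ≤ Q) (hinj : ∀ u ∈ A, u ∈ Q → u ∈ P)
    (hsurj : ∀ u ∈ B, ∃ v ∈ A, v⁻¹ * u ∈ Q) :
    ∃ e : A ⧸ P.subgroupOf A ≃* B ⧸ Q.subgroupOf B,
      ∀ (u : G) (hu : u ∈ A) (hu' : u ∈ B),
        e (QuotientGroup.mk ⟨u, hu⟩) = QuotientGroup.mk ⟨u, hu'⟩ := by
  let f : A ⧸ P.subgroupOf A →* B ⧸ Q.subgroupOf B :=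
    QuotientGroup.map _ _ (Subgroup.inclusion hAB) fun u hu => hPQ hu
  refine ⟨MulEquiv.ofBijective f ⟨?_, ?_⟩, fun u hu hu' => rfl⟩
  · refine (injective_iff_map_eq_one f).2 fun q => ?_
    obtain ⟨u, rfl⟩ := QuotientGroup.mk_surjective q
    intro hu
    have hu' : (u : G) ∈ Q := (QuotientGroup.eq_one_iff (Subgroup.inclusion hAB u)).1 hu
    exact (QuotientGroup.eq_one_iff _).2 (hinj u u.2 hu')
  · intro q
    obtain ⟨u, rfl⟩ := QuotientGroup.mk_surjective q
    obtain ⟨v, hv, huv⟩ := hsurj u u.2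
    exact ⟨QuotientGroup.mk ⟨v, hv⟩, QuotientGroup.eq.2 huv⟩

set_option linter.unusedSectionVars false

/-- A nonzero ideal prime to `m ≠ 0` contains a nonzero element congruent to `1` modulo `m`. -/
theorem exists_ne_zero_mem_dvd_sub_one {R : Type*} [CommRing R] [IsDomain R] {a : Ideal R} {m : R}
    (hm : m ≠ 0) (ha : a ≠ 0) (ham : a ⊔ Ideal.span {m} = ⊤) :
    ∃ t, t ≠ 0 ∧ t ∈ a ∧ m ∣ t - 1 := by
  obtain ⟨t, hta, s, hs, hts⟩ := Submodule.mem_sup.1 ((Ideal.eq_top_iff_one _).1 ham)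
  have htm : m ∣ t - 1 := by
    rw [← hts, sub_add_cancel_left, dvd_neg]
    exact Ideal.mem_span_singleton.1 hs
  rcases ne_or_eq t 0 with ht | rfl
  · exact ⟨t, ht, hta, htm⟩
  · obtain ⟨y, hya, hy0⟩ := Submodule.exists_mem_ne_zero_of_ne_bot ha
    refine ⟨m * y, mul_ne_zero hm hy0, Ideal.mul_mem_left _ _ hya, ?_⟩
    have : m * y - 1 = m * y + (0 - 1) := by ring
    exact this ▸ dvd_add (dvd_mul_right m y) htm

section InvertibleIdeals

variable {R F : Type*} [CommRing R] [IsDomain R] [Field F] [Algebra R F] [IsFractionRing R F]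

/-- A nonzero principal ideal is invertible as a fractional ideal. -/
theorem isUnit_coeIdeal_span_singleton {x : R} (hx : x ≠ 0) :
    IsUnit ((Ideal.span {x} : Ideal R) : FractionalIdeal R⁰ F) := by
  have hx' : algebraMap R F x ≠ 0 := by
    simpa using (IsFractionRing.injective R F).ne hx
  refine IsUnit.of_mul_eq_one (FractionalIdeal.spanSingleton R⁰ (algebraMap R F x)⁻¹) ?_
  rw [FractionalIdeal.coeIdeal_span_singleton, FractionalIdeal.spanSingleton_mul_spanSingleton,
    mul_inv_cancel₀ hx', FractionalIdeal.spanSingleton_one]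

/-- For an invertible ideal, to contain is to divide. -/
theorem exists_mul_eq_span_singleton {a : Ideal R} (ha : IsUnit (a : FractionalIdeal R⁰ F))
    {x : R} (hx : x ∈ a) : ∃ b : Ideal R, a * b = Ideal.span {x} := by
  obtain ⟨u, hu⟩ := ha
  have hle : ((Ideal.span {x} : Ideal R) : FractionalIdeal R⁰ F) ≤ a :=
    (FractionalIdeal.coeIdeal_le_coeIdeal F).2 ((Ideal.span_singleton_le_iff_mem _).2 hx)
  have h1 : (↑u⁻¹ : FractionalIdeal R⁰ F) * (Ideal.span {x} : Ideal R) ≤ 1 := by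
    calc (↑u⁻¹ : FractionalIdeal R⁰ F) * (Ideal.span {x} : Ideal R)
        ≤ ↑u⁻¹ * a := mul_le_mul_right hle _
      _ = 1 := by rw [← hu, Units.inv_mul]
  obtain ⟨b, hb⟩ := FractionalIdeal.le_one_iff_exists_coeIdeal.1 h1
  refine ⟨b, FractionalIdeal.coeIdeal_injective (K := F) ?_⟩
  simp only [FractionalIdeal.coeIdeal_mul, hb, ← hu, Units.mul_inv_cancel_left]

/-- Nakayama's lemma for an invertible ideal. -/
theorem not_le_mul_of_isUnit {a p : Ideal R} (ha : IsUnit (a : FractionalIdeal R⁰ F))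
    (hp : p ≠ ⊤) : ¬ a ≤ p * a := by
  intro h
  obtain ⟨u, hu⟩ := ha
  have h1 : (a : FractionalIdeal R⁰ F) ≤ p * a := by
    rw [← FractionalIdeal.coeIdeal_mul]
    exact (FractionalIdeal.coeIdeal_le_coeIdeal F).2 h
  have h2 : ((⊤ : Ideal R) : FractionalIdeal R⁰ F) ≤ p := by
    calc ((⊤ : Ideal R) : FractionalIdeal R⁰ F) = a * ↑u⁻¹ := by
          rw [← hu, Units.mul_inv, FractionalIdeal.coeIdeal_top]
      _ ≤ p * a * ↑u⁻¹ := mul_le_mul_left h1 _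
      _ = p := by rw [← hu, Units.mul_inv_cancel_right]
  exact hp (top_le_iff.1 ((FractionalIdeal.coeIdeal_le_coeIdeal F).1 h2))

/-- An invertible ideal prime to `n` contains an element congruent to `1` modulo `n` which
generates it locally at finitely many given maximal ideals not containing `n`. -/
theorem exists_mem_dvd_sub_one_forall_notMem_mul {a : Ideal R}
    (ha : IsUnit (a : FractionalIdeal R⁰ F)) {n : R} (han : a ⊔ Ideal.span {n} = ⊤)
    (S : Finset (Ideal R)) (hS : ∀ p ∈ S, p.IsMaximal ∧ n ∉ p) :
    ∃ x ∈ a, n ∣ x - 1 ∧ ∀ p ∈ S, x ∉ p * a := by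
  classical
  induction S using Finset.induction_on with
  | empty =>
    obtain ⟨x, hx, y, hy, hxy⟩ := Submodule.mem_sup.1 ((Ideal.eq_top_iff_one _).1 han)
    refine ⟨x, hx, ?_, by simp⟩
    rw [← hxy, sub_add_cancel_left, dvd_neg]
    exact Ideal.mem_span_singleton.1 hy
  | insert p S hpS ih =>
    obtain ⟨x, hxa, hxn, hxS⟩ := ih fun q hq => hS q (Finset.mem_insert_of_mem hq)
    obtain ⟨hpmax, hnp⟩ := hS p (Finset.mem_insert_self _ _)
    by_cases hxp : x ∈ p * a
    swap
    · refine ⟨x, hxa, hxn, fun q hq => ?_⟩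
      rcases Finset.mem_insert.1 hq with rfl | hq
      · exact hxp
      · exact hxS q hq
    have hprod : ¬ ∏ q ∈ S, q ≤ p := by
      rw [hpmax.isPrime.prod_le]
      rintro ⟨q, hq, hqp⟩
      have := (hS q (Finset.mem_insert_of_mem hq)).1.eq_of_le hpmax.ne_top hqp
      exact hpS (this ▸ hq)
    obtain ⟨e, he, hep⟩ := SetLike.not_le_iff_exists.1 hprod
    obtain ⟨y, hya, hyp⟩ := SetLike.not_le_iff_exists.1 (not_le_mul_of_isUnit ha hpmax.ne_top)
    have hnep : n * e ∉ p := fun h => (hpmax.isPrime.mem_or_mem h).elim hnp hep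
    have key : n * e * y ∉ p * a := by
      intro h
      obtain ⟨r, hr⟩ := Ideal.IsMaximal.exists_inv hpmax hnep
      obtain ⟨i, hi, hri⟩ := hr
      apply hyp
      have : y = r * (n * e * y) + i * y := by linear_combination -y * hri
      rw [this]
      exact Ideal.add_mem _ (Ideal.mul_mem_left _ _ h) (Ideal.mul_mem_mul hi hya)
    refine ⟨x + n * e * y, Ideal.add_mem _ hxa (Ideal.mul_mem_left _ _ hya), ?_, fun q hq => ?_⟩
    · rw [add_sub_right_comm]
      exact dvd_add hxn ⟨e * y, by ring⟩
    · rcases Finset.mem_insert.1 hq with rfl | hq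
      · exact fun h => key ((Ideal.add_mem_iff_right _ hxp).1 h)
      · have heq : n * e ∈ q :=
          Ideal.mul_mem_left _ _ (Finset.inf_le (f := id) hq (Ideal.prod_le_inf he))
        exact fun h => hxS q hq ((Ideal.add_mem_iff_left _ (Ideal.mul_mem_mul heq hya)).1 h)

/-- An invertible ideal `a` prime to `n` has, up to a principal ideal generated by an element
congruent to `1` modulo `n`, an inverse prime to any given nonzero multiple `m` of `n`. -/
theorem exists_mul_eq_span_singleton_sup_eq_top {a : Ideal R}
    (ha : IsUnit (a : FractionalIdeal R⁰ F)) {m n : R} (hm : m ≠ 0) (hnm : n ∣ m)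
    (hfin : {p : Ideal R | m ∈ p}.Finite) (han : a ⊔ Ideal.span {n} = ⊤) :
    ∃ x : R, ∃ b : Ideal R, x ≠ 0 ∧ n ∣ x - 1 ∧ a * b = Ideal.span {x} ∧
      b ⊔ Ideal.span {m} = ⊤ := by
  classical
  have hfin' : {p : Ideal R | m ∈ p ∧ p.IsMaximal ∧ n ∉ p}.Finite := hfin.subset fun p hp => hp.1
  obtain ⟨x, hxa, hxn, hxS⟩ : ∃ x ∈ a, n ∣ x - 1 ∧
      ∀ p : Ideal R, m ∈ p → p.IsMaximal → n ∉ p → x ∉ p * a := by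
    obtain ⟨x, hxa, hxn, hxS⟩ := exists_mem_dvd_sub_one_forall_notMem_mul ha han
      hfin'.toFinset (fun p hp => ((Set.Finite.mem_toFinset _).1 hp).2)
    exact ⟨x, hxa, hxn, fun p h1 h2 h3 => hxS p ((Set.Finite.mem_toFinset _).2 ⟨h1, h2, h3⟩)⟩
  have ha0 : a ≠ ⊥ := by
    rintro rfl
    simp at ha
  obtain ⟨x, hx0, hxa, hxn, hxS⟩ : ∃ x, x ≠ 0 ∧ x ∈ a ∧ n ∣ x - 1 ∧
      ∀ p : Ideal R, m ∈ p → p.IsMaximal → n ∉ p → x ∉ p * a := by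
    rcases ne_or_eq x 0 with hx | rfl
    · exact ⟨x, hx, hxa, hxn, hxS⟩
    obtain ⟨y, hya, hy0⟩ := Submodule.exists_mem_ne_zero_of_ne_bot ha0
    refine ⟨m * y, mul_ne_zero hm hy0, Ideal.mul_mem_left _ _ hya, ?_, fun p h1 h2 h3 => ?_⟩
    · rw [zero_sub] at hxn
      exact dvd_add (hnm.mul_right y) hxn |>.trans (by rw [sub_eq_add_neg])
    · exact absurd (zero_mem _) (hxS p h1 h2 h3)
  obtain ⟨b, hb⟩ := exists_mul_eq_span_singleton ha hxa
  refine ⟨x, b, hx0, hxn, hb, ?_⟩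
  by_contra htop
  obtain ⟨p, hp, hle⟩ := Ideal.exists_le_maximal _ htop
  have hbp : b ≤ p := le_sup_left.trans hle
  have hmp : m ∈ p := hle (Ideal.mem_sup_right (Ideal.mem_span_singleton_self m))
  have hxab : x ∈ a * b := hb.symm ▸ Ideal.mem_span_singleton_self x
  by_cases hnp : n ∈ p
  · have hab : a * b ≤ b := Ideal.mul_le_right
    have hxp : x ∈ p := hbp (hab hxab)
    have h1 : x - 1 ∈ p := Ideal.mem_of_dvd _ hxn hnp
    exact hp.ne_top ((Ideal.eq_top_iff_one _).2 (by simpa using Ideal.sub_mem _ hxp h1))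
  · have hab : a * b ≤ p * a := by
      rw [mul_comm p a]
      exact Ideal.mul_mono_right hbp
    exact hxS p hmp hp hnp (hab hxab)

end InvertibleIdeals

section Orders

variable {K : Type} [Field K] [NumberField K] {O : Subalgebra ℤ K}

theorem IsImagQuadOrder.exists_natCast_mul_mem (hO : IsImagQuadOrder K O) (x : K) :
    ∃ n : ℕ, n ≠ 0 ∧ (n : K) * x ∈ O := by
  have hx : x ∈ Submodule.span ℚ (O : Set K) := hO.spans ▸ Submodule.mem_top
  induction hx using Submodule.span_induction with
  | mem y hy => exact ⟨1, one_ne_zero, by simpa using hy⟩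
  | zero => exact ⟨1, one_ne_zero, by simp⟩
  | add y z _ _ hy hz =>
    obtain ⟨k, hk, hky⟩ := hy
    obtain ⟨l, hl, hlz⟩ := hz
    refine ⟨k * l, mul_ne_zero hk hl, ?_⟩
    have : ((k * l : ℕ) : K) * (y + z) = (l : K) * (k * y) + k * (l * z) := by push_cast; ring
    rw [this]
    exact add_mem (mul_mem (natCast_mem O l) hky) (mul_mem (natCast_mem O k) hlz)
  | smul q y _ hy =>
    obtain ⟨k, hk, hky⟩ := hy
    refine ⟨k * q.den, mul_ne_zero hk q.den_nz, ?_⟩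
    have hq : (q : K) * q.den = q.num := by exact_mod_cast congrArg (Rat.cast (K := K)) q.mul_den_eq_num
    have : ((k * q.den : ℕ) : K) * (q • y) = (q.num : K) * (k * y) := by
      rw [Rat.smul_def, ← hq]; push_cast; ring
    rw [this]
    exact mul_mem (intCast_mem O _) hky

theorem IsImagQuadOrder.isFractionRing (hO : IsImagQuadOrder K O) : IsFractionRing O K := by
  refine IsFractionRing.of_field O K fun x => ?_
  obtain ⟨n, hn, hnx⟩ := hO.exists_natCast_mul_mem x
  refine ⟨⟨_, hnx⟩, (n : O), ?_⟩
  have : (n : K) ≠ 0 := Nat.cast_ne_zero.2 hn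
  have h1 : algebraMap O K ⟨_, hnx⟩ = n * x := rfl
  rw [h1, map_natCast]
  field_simp

theorem IsImagQuadOrder.exists_natCast_mul_mem_of_fg (hO : IsImagQuadOrder K O)
    {A : Submodule ℤ K} (hA : A.FG) : ∃ n : ℕ, n ≠ 0 ∧ ∀ x ∈ A, (n : K) * x ∈ O := by
  induction A, hA using Submodule.fg_induction with
  | singleton x =>
    obtain ⟨n, hn, hnx⟩ := hO.exists_natCast_mul_mem x
    refine ⟨n, hn, fun y hy => ?_⟩
    obtain ⟨z, rfl⟩ := Submodule.mem_span_singleton.1 hy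
    rw [mul_smul_comm]
    exact zsmul_mem hnx z
  | sup A B _ _ hA hB =>
    obtain ⟨k, hk, hkA⟩ := hA
    obtain ⟨l, hl, hlB⟩ := hB
    refine ⟨k * l, mul_ne_zero hk hl, fun x hx => ?_⟩
    obtain ⟨y, hy, z, hz, rfl⟩ := Submodule.mem_sup.1 hx
    have : ((k * l : ℕ) : K) * (y + z) = (l : K) * (k * y) + k * (l * z) := by push_cast; ring
    rw [this]
    exact add_mem (mul_mem (natCast_mem O l) (hkA y hy)) (mul_mem (natCast_mem O k) (hlB z hz))

theorem IsImagQuadOrder.condOrder_ne_zero (hO : IsImagQuadOrder K O) : condOrder K O ≠ 0 := by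
  have hfg : (Subalgebra.toSubmodule (integralClosure ℤ K)).FG :=
    Module.Finite.iff_fg.1 (inferInstanceAs (Module.Finite ℤ (NumberField.RingOfIntegers K)))
  obtain ⟨n, hn, h⟩ := hO.exists_natCast_mul_mem_of_fg hfg
  refine (Submodule.isFiniteRelIndex_of_map_linearMapMulLeft_le hn hfg ?_).relIndex_ne_zero
  rintro _ ⟨x, hx, rfl⟩
  exact h x hx

theorem IsImagQuadOrder.finite_setOf_natCast_mem (hO : IsImagQuadOrder K O) {m : ℕ} (hm : m ≠ 0) :
    {p : Ideal O | (m : O) ∈ p}.Finite := by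
  have : Module.Finite ℤ O := Module.Finite.iff_fg.2 hO.fg
  have hm' : (Ideal.span {(m : O)} : Ideal O) ≠ 0 := by
    rw [Ideal.zero_eq_bot, ne_eq, Ideal.span_singleton_eq_bot]
    exact Nat.cast_ne_zero.2 hm
  have : Finite (O ⧸ (Ideal.span {(m : O)} : Ideal O)) :=
    Ring.HasFiniteQuotients.finiteQuotient hm'
  have : Finite (Ideal (O ⧸ (Ideal.span {(m : O)} : Ideal O))) :=
    Finite.of_injective _ SetLike.coe_injective
  refine (Set.finite_range (Ideal.comap (Ideal.Quotient.mk (Ideal.span {(m : O)})))).subset ?_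
  intro p hp
  refine ⟨p.map (Ideal.Quotient.mk _), ?_⟩
  rw [Ideal.comap_map_quotientMk, sup_eq_right]
  exact (Ideal.span_singleton_le_iff_mem p).2 hp

theorem primeTo_mul {m : ℕ} {a b : Ideal O} :
    primeTo K O m (a * b) ↔ primeTo K O m a ∧ primeTo K O m b := by
  simp only [primeTo, ← Ideal.isCoprime_iff_sup_eq, IsCoprime.mul_left_iff]

theorem primeTo.of_mul {m n : ℕ} {a : Ideal O} (h : primeTo K O (m * n) a) : primeTo K O n a := by
  refine top_le_iff.1 (h.symm.le.trans (sup_le_sup_left ?_ a))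
  exact Ideal.span_singleton_le_span_singleton.2 ⟨m, by push_cast; ring⟩

theorem Igrp_mul_le (m n : ℕ) : Igrp K O (m * n) ≤ Igrp K O n :=
  Subgroup.closure_mono fun _ ⟨a, ha, hu⟩ => ⟨a, ⟨ha.1, ha.2.1.of_mul, ha.2.2⟩, hu⟩

theorem PgrpM_le_Pgrp (n m : ℕ) : PgrpM K O n m ≤ Pgrp K O n :=
  Subgroup.closure_mono fun _ ⟨ν, h0, _, h1, hu⟩ => ⟨ν, h0, h1, hu⟩

theorem Mset_mul_mem [IsFractionRing O K] {m : ℕ} {a b : Ideal O} (ha : a ∈ Mset K O m)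
    (hb : b ∈ Mset K O m) : a * b ∈ Mset K O m :=
  ⟨mul_ne_zero ha.1 hb.1, primeTo_mul.2 ⟨ha.2.1, hb.2.1⟩, by
    rw [FractionalIdeal.coeIdeal_mul]; exact ha.2.2.mul hb.2.2⟩

theorem top_mem_Mset (m : ℕ) : (⊤ : Ideal O) ∈ Mset K O m :=
  ⟨by simp, by simp [primeTo], by simp⟩

/-- Elements of `I(O, m)` are quotients of elements of `M(O, m)`. -/
theorem exists_mul_coe_eq_of_mem_Igrp [IsFractionRing O K] {m : ℕ} {u : (Frac K O)ˣ}
    (hu : u ∈ Igrp K O m) :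
    ∃ a ∈ Mset K O m, ∃ b ∈ Mset K O m, (u : Frac K O) * (b : Frac K O) = (a : Frac K O) := by
  induction hu using Subgroup.closure_induction with
  | mem u hu =>
    obtain ⟨a, ha, hu⟩ := hu
    exact ⟨a, ha, ⊤, top_mem_Mset m, by simp [hu]⟩
  | one => exact ⟨⊤, top_mem_Mset m, ⊤, top_mem_Mset m, by simp⟩
  | mul u v _ _ hu hv =>
    obtain ⟨a, ha, b, hb, hu⟩ := hu
    obtain ⟨c, hc, d, hd, hv⟩ := hv
    refine ⟨_, Mset_mul_mem ha hc, _, Mset_mul_mem hb hd, ?_⟩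
    rw [FractionalIdeal.coeIdeal_mul, FractionalIdeal.coeIdeal_mul, ← hu, ← hv, Units.val_mul]
    ring
  | inv u _ hu =>
    obtain ⟨a, ha, b, hb, hu⟩ := hu
    exact ⟨b, hb, a, ha, by rw [← hu, Units.inv_mul_cancel_left]⟩

/-- Elements of `P_N(O)` are generated by quotients of elements congruent to `1` modulo `N`. -/
theorem exists_mul_span_singleton_eq_of_mem_Pgrp {n : ℕ} {u : (Frac K O)ˣ}
    (hu : u ∈ Pgrp K O n) :
    ∃ x y : O, x ≠ 0 ∧ y ≠ 0 ∧ (n : O) ∣ x - 1 ∧ (n : O) ∣ y - 1 ∧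
      (u : Frac K O) * ((Ideal.span {y} : Ideal O) : Frac K O) =
        ((Ideal.span {x} : Ideal O) : Frac K O) := by
  induction hu using Subgroup.closure_induction with
  | mem u hu =>
    obtain ⟨x, hx, ⟨z, hz⟩, hu⟩ := hu
    exact ⟨x, 1, hx, one_ne_zero, ⟨z, by rw [hz]; ring⟩, by simp, by simp [hu]⟩
  | one => exact ⟨1, 1, one_ne_zero, one_ne_zero, by simp, by simp, by simp⟩
  | mul u v _ _ hu hv =>
    obtain ⟨x, y, hx, hy, hxn, hyn, hu⟩ := hu
    obtain ⟨z, w, hz, hw, hzn, hwn, hv⟩ := hv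
    refine ⟨x * z, y * w, mul_ne_zero hx hz, mul_ne_zero hy hw, ?_, ?_, ?_⟩
    · have : x * z - 1 = (x - 1) * z + (z - 1) := by ring
      exact this ▸ dvd_add (hxn.mul_right _) hzn
    · have : y * w - 1 = (y - 1) * w + (w - 1) := by ring
      exact this ▸ dvd_add (hyn.mul_right _) hwn
    · rw [← Ideal.span_singleton_mul_span_singleton, ← Ideal.span_singleton_mul_span_singleton,
        FractionalIdeal.coeIdeal_mul, FractionalIdeal.coeIdeal_mul, ← hu, ← hv, Units.val_mul]
      ring
  | inv u _ hu =>
    obtain ⟨x, y, hx, hy, hxn, hyn, hu⟩ := hu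
    exact ⟨y, x, hy, hx, hyn, hxn, by rw [← hu, Units.inv_mul_cancel_left]⟩

theorem mem_PgrpM_of_mem_Igrp_of_mem_Pgrp [IsFractionRing O K] {n m : ℕ} (hm : m ≠ 0)
    (hnm : n ∣ m) {u : (Frac K O)ˣ} (hI : u ∈ Igrp K O m) (hP : u ∈ Pgrp K O n) : u ∈ PgrpM K O n m := by
  obtain ⟨a, ha, b, hb, hab⟩ := exists_mul_coe_eq_of_mem_Igrp hI
  obtain ⟨x, y, hx, hy, hxn, hyn, hxy⟩ := exists_mul_span_singleton_eq_of_mem_Pgrp hP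
  have hnm' : (n : O) ∣ (m : O) := Nat.cast_dvd_cast hnm
  have hya : Ideal.span {x} * b = Ideal.span {y} * a := by
    refine FractionalIdeal.coeIdeal_injective (K := K) ?_
    simp only [FractionalIdeal.coeIdeal_mul]
    rw [← hab, ← hxy]
    ring
  obtain ⟨t, ht0, htb, htm⟩ := exists_ne_zero_mem_dvd_sub_one (Nat.cast_ne_zero.2 hm) hb.1 hb.2.1
  obtain ⟨c, hc⟩ := exists_mul_eq_span_singleton hb.2.2 htb
  have hxt : x * t ∈ Ideal.span {y} * a :=
    hya ▸ Ideal.mul_mem_mul (Ideal.mem_span_singleton_self x) htb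
  obtain ⟨z, -, hz⟩ := Ideal.mem_span_singleton_mul.1 hxt
  have hz0 : z ≠ 0 := right_ne_zero_of_mul (hz ▸ mul_ne_zero hx ht0)
  have hzn : (n : O) ∣ z - 1 := by
    have : z - 1 = (x - 1) * t + (t - 1) - (y - 1) * z := by linear_combination hz
    rw [this]
    exact dvd_sub (dvd_add (hxn.mul_right _) (hnm'.trans htm)) (hyn.mul_right _)
  have hxtz : Ideal.span {x} * Ideal.span {t} = Ideal.span {y} * Ideal.span {z} := by
    rw [Ideal.span_singleton_mul_span_singleton, Ideal.span_singleton_mul_span_singleton, hz]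
  have hac : a * c = Ideal.span {z} := by
    refine (Ideal.span_singleton_mul_right_inj hy).1 ?_
    rw [← hxtz, ← hc, ← mul_assoc, ← mul_assoc, hya]
  have htM : primeTo K O m (Ideal.span {t}) := by
    obtain ⟨w, hw⟩ := htm
    refine (Ideal.eq_top_iff_one _).2 (Submodule.mem_sup.2
      ⟨t, Ideal.mem_span_singleton_self t, m * -w, Ideal.mul_mem_right _ _
        (Ideal.mem_span_singleton_self _), by linear_combination hw⟩)
  have hzM : primeTo K O m (Ideal.span {z}) :=
    hac ▸ primeTo_mul.2 ⟨ha.2.1, (primeTo_mul.1 (hc ▸ htM)).2⟩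
  have hut : (u : Frac K O) * ((Ideal.span {t} : Ideal O) : Frac K O) =
      ((Ideal.span {z} : Ideal O) : Frac K O) := by
    rw [← hc, ← hac, FractionalIdeal.coeIdeal_mul, FractionalIdeal.coeIdeal_mul, ← mul_assoc, hab]
  obtain ⟨v, hv⟩ := isUnit_coeIdeal_span_singleton (F := K) ht0
  obtain ⟨w, hw⟩ := isUnit_coeIdeal_span_singleton (F := K) hz0
  have huvw : u = w * v⁻¹ := by
    rw [eq_mul_inv_iff_mul_eq]
    exact Units.ext (by rw [Units.val_mul, hv, hw, hut])
  obtain ⟨k, hk⟩ := hzn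
  obtain ⟨l, hl⟩ := hnm'.trans htm
  rw [huvw]
  exact mul_mem (Subgroup.subset_closure ⟨z, hz0, hzM, ⟨k, by rw [← hk, add_sub_cancel]⟩, hw⟩)
    (inv_mem (Subgroup.subset_closure ⟨t, ht0, htM, ⟨l, by rw [← hl, add_sub_cancel]⟩, hv⟩))

/-- Every class of `C_N(O)` has a representative in `I(O, m)`. -/
theorem exists_mem_Igrp_inv_mul_mem_Pgrp (hO : IsImagQuadOrder K O) {n m : ℕ} (hm : m ≠ 0)
    (hnm : n ∣ m) {u : (Frac K O)ˣ} (hu : u ∈ Igrp K O n) :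
    ∃ v ∈ Igrp K O m, v⁻¹ * u ∈ Pgrp K O n := by
  have := hO.isFractionRing
  induction hu using Subgroup.closure_induction with
  | mem u hu =>
    obtain ⟨a, ⟨ha0, han, ha⟩, hu⟩ := hu
    obtain ⟨x, b, hx, ⟨z, hz⟩, hab, hbm⟩ := exists_mul_eq_span_singleton_sup_eq_top ha
      (Nat.cast_ne_zero.2 hm) (Nat.cast_dvd_cast hnm) (hO.finite_setOf_natCast_mem hm) han
    have habF : (a : Frac K O) * (b : Frac K O) = ((Ideal.span {x} : Ideal O) : Frac K O) := by
      rw [← FractionalIdeal.coeIdeal_mul, hab]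
    have hb : IsUnit (b : Frac K O) :=
      isUnit_of_mul_isUnit_right (habF ▸ isUnit_coeIdeal_span_singleton hx)
    have hb0 : b ≠ 0 := by
      rintro rfl
      exact hx (by simpa using hab.symm)
    obtain ⟨v, hv⟩ := hb
    refine ⟨v⁻¹, inv_mem (Subgroup.subset_closure ⟨b, ⟨hb0, hbm, ⟨v, hv⟩⟩, hv⟩),
      Subgroup.subset_closure ⟨x, hx, ⟨z, ?_⟩, ?_⟩⟩
    · rw [← hz, add_sub_cancel]
    · rw [inv_inv, Units.val_mul, hu, hv, mul_comm, habF]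
  | one => exact ⟨1, one_mem _, by simp⟩
  | mul u u' _ _ hu hu' =>
    obtain ⟨v, hv, huv⟩ := hu
    obtain ⟨v', hv', huv'⟩ := hu'
    refine ⟨v * v', mul_mem hv hv', ?_⟩
    have : (v * v')⁻¹ * (u * u') = v⁻¹ * u * (v'⁻¹ * u') := by
      rw [mul_inv, mul_mul_mul_comm]
    exact this ▸ mul_mem huv huv'
  | inv u _ hu =>
    obtain ⟨v, hv, huv⟩ := hu
    refine ⟨v⁻¹, inv_mem hv, ?_⟩
    have : v⁻¹⁻¹ * u⁻¹ = (v⁻¹ * u)⁻¹ := by rw [mul_inv]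
    exact this ▸ inv_mem huv

end Orders

/-!
STATEMENT 4: the inclusion `I(O, ℓ_O N) ↪ I(O, N)` induces a group isomorphism
`C_N(O, ℓ_O N) = I(O, ℓ_O N)/P_N(O, ℓ_O N) ≅ C_N(O) = I(O, N)/P_N(O)`.
-/

theorem statement4 (K : Type) [Field K] [NumberField K]
    (O : Subalgebra ℤ K) (hO : IsImagQuadOrder K O) (N : ℕ) (hN : 0 < N) :
    ∃ e : ClsGrpM K O N (condOrder K O * N) ≃* ClsGrp K O N,
      ∀ (u : (Frac K O)ˣ) (hu : u ∈ Igrp K O (condOrder K O * N)) (hu' : u ∈ Igrp K O N),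
        e (QuotientGroup.mk ⟨u, hu⟩) = QuotientGroup.mk ⟨u, hu'⟩ := by
  have := hO.isFractionRing
  have hM : condOrder K O * N ≠ 0 := mul_ne_zero hO.condOrder_ne_zero hN.ne'
  have hle : Igrp K O (condOrder K O * N) ≤ Igrp K O N := Igrp_mul_le _ _
  exact exists_mulEquiv_quotient_subgroupOf hle (PgrpM_le_Pgrp N _)
    (fun u hu hu' => mem_PgrpM_of_mem_Igrp_of_mem_Pgrp hM (dvd_mul_left _ _) hu hu')
    (fun u hu => exists_mem_Igrp_inv_mul_mem_Pgrp hO hM (dvd_mul_left _ _) hu)
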